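/- Let F : ℝ → M₃(ℝ) be differentiable, let ν ∈ ℝ³ be a unit vector, and suppose J(t) := ‖cof(F(t)) ν‖ > 0 at some t. With n(t) := cof(F(t)) ν / J(t), the function t ↦ −ν · n(t) is differentiable at t with derivative (d/dt)(−ν · n(t)) = (1/J(t)) ( (ν · n(t)) (n(t) · C'(t) ν) − ν · C'(t) ν ), where C'(t) := d/dt cof(F(t)); equivalently, in the F# notation, δ(−ν·n) = (1/J)((ν·n) F#_{ν,n} − F#_{ν,ν}) : F'. -/

import Mathlib

open Matrix

attribute [local instance] Matrix.normedAddCommGroup Matrix.normedSpace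

/-- The cofactor matrix of a real 3×3 matrix: the transpose of the adjugate. -/
noncomputable def cof (A : Matrix (Fin 3) (Fin 3) ℝ) : Matrix (Fin 3) (Fin 3) ℝ :=
  A.adjugateᵀ

/-- The cofactor matrix of a real 2×2 matrix. -/
noncomputable def cof2 (A : Matrix (Fin 2) (Fin 2) ℝ) : Matrix (Fin 2) (Fin 2) ℝ :=
  A.adjugateᵀ

/-- The Euclidean norm on `ℝ³`. -/
noncomputable def enorm3 (v : Fin 3 → ℝ) : ℝ := Real.sqrt (v ⬝ᵥ v)

/-- Index of `k` inside the 2-element index set obtained from `Fin 3` by deleting `i`. -/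
def delIdx (i k : Fin 3) : Fin 2 :=
  if h : (k : ℕ) < (i : ℕ) then ⟨(k : ℕ), by omega⟩
  else ⟨(k : ℕ) - 1, by have := k.2; omega⟩

/-- `A#_{ij}`: zero on row `i` and column `j`, elsewhere the signed cofactors of the 2×2
submatrix of `A` with row `i` and column `j` deleted. -/
noncomputable def sharp (A : Matrix (Fin 3) (Fin 3) ℝ) (i j : Fin 3) :
    Matrix (Fin 3) (Fin 3) ℝ :=
  Matrix.of fun k l =>
    if k = i ∨ l = j then 0
    else (-1 : ℝ) ^ ((i : ℕ) + (j : ℕ)) *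
      cof2 (A.submatrix i.succAbove j.succAbove) (delIdx i k) (delIdx j l)

/-- The Frobenius inner product `M : N = ∑ₖₗ Mₖₗ Nₖₗ`. -/
def frobInner (M N : Matrix (Fin 3) (Fin 3) ℝ) : ℝ := ∑ k, ∑ l, M k l * N k l

/-- The contraction `F#_{x,y} : H := ∑ᵢⱼ yᵢ (F#_{ij} : H) xⱼ`. -/
noncomputable def sharpPair (F : Matrix (Fin 3) (Fin 3) ℝ) (x y : Fin 3 → ℝ)
    (H : Matrix (Fin 3) (Fin 3) ℝ) : ℝ :=
  ∑ i, ∑ j, y i * frobInner (sharp F i j) H * x j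

/-- The entry of the cofactor matrix of a `3 × 3` matrix in cyclic form, without signs. -/
theorem cof_apply (A : Matrix (Fin 3) (Fin 3) ℝ) (i j : Fin 3) :
    cof A i j =
      A (i + 1) (j + 1) * A (i + 2) (j + 2) - A (i + 1) (j + 2) * A (i + 2) (j + 1) := by
  fin_cases i <;> fin_cases j <;> simp [cof, adjugate_fin_three] <;> ring

/-- The contraction of `sharp A i j` with `H` is the linearization of the cyclic form of the
cofactor `cof A i j` in the direction `H`. -/
theorem frobInner_sharp (A H : Matrix (Fin 3) (Fin 3) ℝ) (i j : Fin 3) :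
    frobInner (sharp A i j) H =
      (H (i + 1) (j + 1) * A (i + 2) (j + 2) + A (i + 1) (j + 1) * H (i + 2) (j + 2)) -
        (H (i + 1) (j + 2) * A (i + 2) (j + 1) + A (i + 1) (j + 2) * H (i + 2) (j + 1)) := by
  fin_cases i <;> fin_cases j <;>
    simp [frobInner, sharp, cof2, adjugate_fin_two, delIdx, Fin.sum_univ_three,
      Fin.succAbove, Fin.lt_def] <;> ring

theorem HasDerivAt.matrix_apply {F : ℝ → Matrix (Fin 3) (Fin 3) ℝ}
    {F' : Matrix (Fin 3) (Fin 3) ℝ} {t : ℝ} (hF : HasDerivAt F F' t) (i j : Fin 3) :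
    HasDerivAt (fun s => F s i j) (F' i j) t :=
  hasDerivAt_pi.1 (hasDerivAt_pi.1 hF i) j

/-- The derivative of the entry `cof (F s) i j` is `F#_{ij} : F'`. -/
theorem HasDerivAt.cof_apply {F : ℝ → Matrix (Fin 3) (Fin 3) ℝ}
    {F' : Matrix (Fin 3) (Fin 3) ℝ} {t : ℝ} (hF : HasDerivAt F F' t) (i j : Fin 3) :
    HasDerivAt (fun s => cof (F s) i j) (frobInner (sharp (F t) i j) F') t := by
  simp only [_root_.cof_apply, frobInner_sharp]
  exact ((hF.matrix_apply _ _).mul (hF.matrix_apply _ _)).sub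
    ((hF.matrix_apply _ _).mul (hF.matrix_apply _ _))

theorem sharpPair_eq_dotProduct {F : ℝ → Matrix (Fin 3) (Fin 3) ℝ}
    {F' C' : Matrix (Fin 3) (Fin 3) ℝ} {t : ℝ} (hF : HasDerivAt F F' t)
    (hC : HasDerivAt (fun s => cof (F s)) C' t) (x y : Fin 3 → ℝ) :
    sharpPair (F t) x y F' = y ⬝ᵥ (C' *ᵥ x) := by
  have h (i j : Fin 3) : frobInner (sharp (F t) i j) F' = C' i j :=
    (hF.cof_apply i j).unique (hC.matrix_apply i j)
  simp only [sharpPair, h, dotProduct, mulVec, Finset.mul_sum, mul_assoc]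

theorem HasDerivAt.dotProduct {v w : ℝ → Fin 3 → ℝ} {v' w' : Fin 3 → ℝ} {t : ℝ}
    (hv : HasDerivAt v v' t) (hw : HasDerivAt w w' t) :
    HasDerivAt (fun s => v s ⬝ᵥ w s) (v' ⬝ᵥ w t + v t ⬝ᵥ w') t := by
  simp only [_root_.dotProduct, ← Finset.sum_add_distrib]
  exact HasDerivAt.fun_sum fun i _ => (hasDerivAt_pi.1 hv i).mul (hasDerivAt_pi.1 hw i)

theorem HasDerivAt.matrix_mulVec_const {M : ℝ → Matrix (Fin 3) (Fin 3) ℝ}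
    {M' : Matrix (Fin 3) (Fin 3) ℝ} {t : ℝ} (hM : HasDerivAt M M' t) (x : Fin 3 → ℝ) :
    HasDerivAt (fun s => M s *ᵥ x) (M' *ᵥ x) t :=
  hasDerivAt_pi.2 fun i => by
    simpa [mulVec] using HasDerivAt.dotProduct (hasDerivAt_pi.1 hM i) (hasDerivAt_const t x)

theorem HasDerivAt.enorm3 {v : ℝ → Fin 3 → ℝ} {v' : Fin 3 → ℝ} {t : ℝ}
    (hv : HasDerivAt v v' t) (h : 0 < enorm3 (v t)) :
    HasDerivAt (fun s => enorm3 (v s)) ((enorm3 (v t))⁻¹ * (v t ⬝ᵥ v')) t := by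
  have hpos : 0 < v t ⬝ᵥ v t := Real.sqrt_pos.1 h
  refine ((hv.dotProduct hv).sqrt hpos.ne').congr_deriv ?_
  change _ / (2 * _root_.enorm3 (v t)) = _
  rw [dotProduct_comm v']
  field_simp
  ring

/-- Let `F : ℝ → M₃(ℝ)` be differentiable, `ν` a unit vector, and
`J(t) := ‖cof(F(t)) ν‖ > 0` at some `t`. With `n(t) := cof(F(t)) ν / J(t)`, the function
`t ↦ −ν · n(t)` is differentiable at `t` with derivative
`(1/J(t)) ((ν·n(t)) (n(t)·C'(t) ν) − ν·C'(t) ν)` where `C'(t) := d/dt cof(F(t))`;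
equivalently, in the `F#` notation, `δ(−ν·n) = (1/J)((ν·n) F#_{ν,n} − F#_{ν,ν}) : F'`. -/
theorem hasDerivAt_neg_nu_dot_n (F F' : ℝ → Matrix (Fin 3) (Fin 3) ℝ)
    (hF : ∀ s, HasDerivAt F (F' s) s)
    (C' : Matrix (Fin 3) (Fin 3) ℝ) (ν : Fin 3 → ℝ) (t : ℝ)
    (hν : enorm3 ν = 1)
    (hC : HasDerivAt (fun s => cof (F s)) C' t)
    (hJ : 0 < enorm3 (cof (F t) *ᵥ ν)) :
    HasDerivAt
      (fun s => -(ν ⬝ᵥ ((enorm3 (cof (F s) *ᵥ ν))⁻¹ • (cof (F s) *ᵥ ν))))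
      ((enorm3 (cof (F t) *ᵥ ν))⁻¹ *
        ((ν ⬝ᵥ ((enorm3 (cof (F t) *ᵥ ν))⁻¹ • (cof (F t) *ᵥ ν))) *
            (((enorm3 (cof (F t) *ᵥ ν))⁻¹ • (cof (F t) *ᵥ ν)) ⬝ᵥ (C' *ᵥ ν)) -
          ν ⬝ᵥ (C' *ᵥ ν))) t ∧
    (enorm3 (cof (F t) *ᵥ ν))⁻¹ *
        ((ν ⬝ᵥ ((enorm3 (cof (F t) *ᵥ ν))⁻¹ • (cof (F t) *ᵥ ν))) *
            (((enorm3 (cof (F t) *ᵥ ν))⁻¹ • (cof (F t) *ᵥ ν)) ⬝ᵥ (C' *ᵥ ν)) -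
          ν ⬝ᵥ (C' *ᵥ ν)) =
      (enorm3 (cof (F t) *ᵥ ν))⁻¹ *
        ((ν ⬝ᵥ ((enorm3 (cof (F t) *ᵥ ν))⁻¹ • (cof (F t) *ᵥ ν))) *
            sharpPair (F t) ν ((enorm3 (cof (F t) *ᵥ ν))⁻¹ • (cof (F t) *ᵥ ν)) (F' t) -
          sharpPair (F t) ν ν (F' t)) := by
  refine ⟨?_, by simp only [sharpPair_eq_dotProduct (hF t) hC]⟩
  have hv := hC.matrix_mulVec_const ν
  have hνv : HasDerivAt (fun s => ν ⬝ᵥ (cof (F s) *ᵥ ν)) (ν ⬝ᵥ (C' *ᵥ ν)) t := by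
    simpa using (hasDerivAt_const t ν).dotProduct hv
  simp only [dotProduct_smul, smul_dotProduct, smul_eq_mul]
  refine (((hv.enorm3 hJ).fun_inv hJ.ne').mul hνv).neg.congr_deriv ?_
  field_simp
  ring
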